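/- arXiv:2506.23710 — 2 statements merged into one kernel-verified Lean document; each statement's English description precedes it below -/
import Mathlib

section
/- Let L be a complete Lie superalgebra. Then every type 2 map of L is inner, i.e., every δ ∈ F_2(L) equals R_t : y ↦ [y,t] for some t ∈ L. -/
namespace SuperBider

/-- The sign `(-1)^{ab}` for `a b : ZMod 2`, valued in the field `F`. -/
def sgn (F : Type*) [Field F] (a b : ZMod 2) : F := (-1) ^ (a * b).val

variable (F : Type*) [Field F] {L : Type*} [AddCommGroup L] [Module F L]
variable (grade : ZMod 2 → Submodule F L) (br : L →ₗ[F] L →ₗ[F] L)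

/-- The bracket respects the `ZMod 2`-grading. -/
def GradedBr : Prop :=
  ∀ a b : ZMod 2, ∀ x ∈ grade a, ∀ y ∈ grade b, br x y ∈ grade (a + b)

/-- Super skew-symmetry: `[x,y] = -(-1)^{|x||y|}[y,x]`. -/
def SuperSkew : Prop :=
  ∀ a b : ZMod 2, ∀ x ∈ grade a, ∀ y ∈ grade b, br x y = -(sgn F a b) • br y x

/-- Graded Jacobi identity (in the form `[x,[y,z]] = [[x,y],z] + (-1)^{|x||y|}[y,[x,z]]`). -/
def SuperJacobi : Prop :=
  ∀ a b c : ZMod 2, ∀ x ∈ grade a, ∀ y ∈ grade b, ∀ z ∈ grade c,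
    br x (br y z) = br (br x y) z + (sgn F a b) • br y (br x z)

/-- `(L, grade, br)` is a Lie superalgebra: the grading is an internal direct sum
decomposition and the bracket is graded, super skew-symmetric and satisfies the
graded Jacobi identity. -/
def IsLieSuper : Prop :=
  DirectSum.IsInternal grade ∧ GradedBr F grade br ∧ SuperSkew F grade br ∧
    SuperJacobi F grade br

/-- A homogeneous linear map of degree `d`. -/
def HomogMap (d : ZMod 2) (f : L →ₗ[F] L) : Prop :=
  ∀ i : ZMod 2, ∀ x ∈ grade i, f x ∈ grade (i + d)

/-- A superderivation (type 1 map) of degree `d`: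
`D[x,y] = [Dx,y] + (-1)^{|D||x|}[x,Dy]`. -/
def IsSuperDer (d : ZMod 2) (D : L →ₗ[F] L) : Prop :=
  HomogMap F grade d D ∧ ∀ a b : ZMod 2, ∀ x ∈ grade a, ∀ y ∈ grade b,
    D (br x y) = br (D x) y + (sgn F d a) • br x (D y)

/-- A type 2 map of degree `d`: `δ[x,y] = (-1)^{|δ||y|}[δx,y] + [x,δy]`. -/
def IsType2 (d : ZMod 2) (δ : L →ₗ[F] L) : Prop :=
  HomogMap F grade d δ ∧ ∀ a b : ZMod 2, ∀ x ∈ grade a, ∀ y ∈ grade b,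
    δ (br x y) = (sgn F d b) • br (δ x) y + br x (δ y)

/-- The space `Der(L)` of superderivations: the span of homogeneous superderivations. -/
def DerS : Submodule F (L →ₗ[F] L) :=
  Submodule.span F {D | ∃ d : ZMod 2, IsSuperDer F grade br d D}

/-- The space `F₂(L)` of type 2 maps: the span of homogeneous type 2 maps. -/
def F2S : Submodule F (L →ₗ[F] L) :=
  Submodule.span F {δ | ∃ d : ZMod 2, IsType2 F grade br d δ}

/-- A superbiderivation of degree `dB`. -/
def IsSuperBider (dB : ZMod 2) (B : L →ₗ[F] L →ₗ[F] L) : Prop :=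
  (∀ a b : ZMod 2, ∀ x ∈ grade a, ∀ y ∈ grade b, B x y ∈ grade (a + b + dB)) ∧
  (∀ a b c : ZMod 2, ∀ x ∈ grade a, ∀ y ∈ grade b, ∀ z ∈ grade c,
    B x (br y z) = br (B x y) z + (sgn F (dB + a) b) • br y (B x z)) ∧
  (∀ a b c : ZMod 2, ∀ x ∈ grade a, ∀ y ∈ grade b, ∀ z ∈ grade c,
    B (br x y) z = (sgn F (dB + c) b) • br (B x z) y + br x (B y z))

/-- The center of `L` is trivial. -/
def CenterTrivial : Prop := ∀ x : L, (∀ y : L, br x y = 0) → x = 0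

end SuperBider

namespace SuperBider

variable {F : Type*} [Field F] {L : Type*} [AddCommGroup L] [Module F L]

lemma sgn_add_right (d a b : ZMod 2) : sgn F d (a + b) = sgn F d a * sgn F d b := by
  have h : (d * (a + b)).val % 2 = ((d * a).val + (d * b).val) % 2 := by
    revert d a b; decide
  rw [sgn, sgn, sgn, ← pow_add, neg_one_pow_eq_pow_mod_two, h, ← neg_one_pow_eq_pow_mod_two]

lemma sgn_mul_self (a b : ZMod 2) : sgn F a b * sgn F a b = 1 := by
  rw [sgn, ← pow_add, ← two_mul, pow_mul, neg_one_sq, one_pow]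

lemma linearMap_ext_of_homogeneous {grade : ZMod 2 → Submodule F L}
    (hgr : DirectSum.IsInternal grade) {f g : L →ₗ[F] L}
    (h : ∀ b, ∀ y ∈ grade b, f y = g y) : f = g := by
  ext y
  have hy : y ∈ ⨆ b, grade b := hgr.submodule_iSup_eq_top ▸ Submodule.mem_top
  induction hy using Submodule.iSup_induction' with
  | mem b y hy => exact h b y hy
  | zero => simp
  | add y z _ _ hy hz => rw [map_add, map_add, hy, hz]

/-- The linear map acting on the degree `b` component as the scalar `(-1)^{db}`. -/
lemma exists_signMap {grade : ZMod 2 → Submodule F L}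
    (hgr : DirectSum.IsInternal grade) (d : ZMod 2) :
    ∃ σ : L →ₗ[F] L, ∀ b, ∀ y ∈ grade b, σ y = sgn F d b • y := by
  let e := LinearEquiv.ofBijective (DirectSum.coeLinearMap grade) hgr
  refine ⟨DirectSum.toModule F (ZMod 2) L (fun b => sgn F d b • (grade b).subtype) ∘ₗ
    e.symm.toLinearMap, fun b y hy => ?_⟩
  have he : e.symm y = DirectSum.lof F (ZMod 2) (fun b => grade b) b ⟨y, hy⟩ := by
    rw [LinearEquiv.symm_apply_eq]
    exact (DirectSum.coeLinearMap_lof grade b ⟨y, hy⟩).symm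
  simp [he]

lemma exists_homogeneous_add {grade : ZMod 2 → Submodule F L}
    (hgr : DirectSum.IsInternal grade) (d : ZMod 2) (x : L) :
    ∃ u ∈ grade d, ∃ v ∈ grade (d + 1), u + v = x := by
  rw [← Submodule.mem_sup]
  have hx : x ∈ ⨆ b, grade b := hgr.submodule_iSup_eq_top ▸ Submodule.mem_top
  refine (iSup_le fun b => ?_ : ⨆ b, grade b ≤ grade d ⊔ grade (d + 1)) hx
  have hb : b = d ∨ b = d + 1 := by revert b d; decide
  rcases hb with rfl | rfl
  exacts [le_sup_left, le_sup_right]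

/-- In a centerless superalgebra, an element whose adjoint map is homogeneous of degree `d`
is itself homogeneous of degree `d`. -/
lemma mem_grade_of_homogMap {grade : ZMod 2 → Submodule F L} {br : L →ₗ[F] L →ₗ[F] L}
    (hgr : DirectSum.IsInternal grade) (hbr : GradedBr F grade br) (hZ : CenterTrivial F br)
    {d : ZMod 2} {x : L} (hx : HomogMap F grade d (br x)) : x ∈ grade d := by
  obtain ⟨u, hu, v, hv, rfl⟩ := exists_homogeneous_add hgr d x
  have hv0 : br v = 0 := by
    refine linearMap_ext_of_homogeneous hgr fun b y hy => ?_
    have h1 : br v y ∈ grade (b + d) := by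
      have hsub := sub_mem (hx b y hy) (add_comm d b ▸ hbr d b u hu y hy)
      simpa using hsub
    have hne : b + d ≠ d + 1 + b := by simp [add_comm, add_left_comm]
    exact Submodule.disjoint_def.mp (hgr.submodule_iSupIndep.pairwiseDisjoint hne) _ h1
      (hbr _ b v hv y hy)
  rw [hZ v fun y => by rw [hv0, LinearMap.zero_apply], add_zero]
  exact hu

/-- Twisting a type 2 map by the sign `(-1)^{db}` yields a superderivation. -/
lemma IsType2.isSuperDer_comp {grade : ZMod 2 → Submodule F L} {br : L →ₗ[F] L →ₗ[F] L}
    (hbr : GradedBr F grade br) {d : ZMod 2} {δ σ : L →ₗ[F] L} (hδ : IsType2 F grade br d δ)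
    (hσ : ∀ b, ∀ y ∈ grade b, σ y = sgn F d b • y) : IsSuperDer F grade br d (δ ∘ₗ σ) := by
  refine ⟨fun i x hx => ?_, fun a b x hx y hy => ?_⟩
  · rw [LinearMap.comp_apply, hσ i x hx, map_smul]
    exact Submodule.smul_mem _ _ (hδ.1 i x hx)
  · simp only [LinearMap.comp_apply, hσ _ _ (hbr a b x hx y hy), hσ a x hx, hσ b y hy, map_smul,
      hδ.2 a b x hx y hy, sgn_add_right, LinearMap.smul_apply, smul_add, smul_smul]
    rw [mul_assoc, sgn_mul_self, mul_one]

lemma IsType2.exists_eq_flip {grade : ZMod 2 → Submodule F L} {br : L →ₗ[F] L →ₗ[F] L}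
    (hL : IsLieSuper F grade br) (hZ : CenterTrivial F br)
    (hinner : ∀ (d : ZMod 2) (D : L →ₗ[F] L), IsSuperDer F grade br d D → ∃ x : L, D = br x)
    {d : ZMod 2} {δ : L →ₗ[F] L} (hδ : IsType2 F grade br d δ) : ∃ t : L, δ = br.flip t := by
  obtain ⟨hgr, hbr, hskew, -⟩ := hL
  obtain ⟨σ, hσ⟩ := exists_signMap hgr d
  have hD := hδ.isSuperDer_comp hbr hσ
  obtain ⟨x, hx⟩ := hinner d _ hD
  have hxd : x ∈ grade d := mem_grade_of_homogMap hgr hbr hZ (hx ▸ hD.1)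
  refine ⟨-x, linearMap_ext_of_homogeneous hgr fun b y hy => ?_⟩
  have hxy : sgn F d b • δ y = br x y := by
    rw [← hx, LinearMap.comp_apply, hσ b y hy, map_smul]
  calc δ y = sgn F d b • sgn F d b • δ y := by rw [smul_smul, sgn_mul_self, one_smul]
    _ = br.flip (-x) y := by
      rw [hxy, hskew d b x hxd y hy, smul_smul, mul_neg, sgn_mul_self]
      simp

/-- in a complete Lie superalgebra every type 2 map is inner, i.e. every
element of `F₂(L)` is a right multiplication `R_t : y ↦ [y,t]`. -/
theorem typeTwo_inner_of_complete
    (grade : ZMod 2 → Submodule F L) (br : L →ₗ[F] L →ₗ[F] L)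
    (hL : IsLieSuper F grade br) (h2 : (2 : F) ≠ 0)
    (hZ : CenterTrivial F br)
    (hinner : ∀ (d : ZMod 2) (D : L →ₗ[F] L), IsSuperDer F grade br d D →
      ∃ x : L, D = br x) :
    ∀ δ ∈ F2S F grade br, ∃ t : L, δ = br.flip t := by
  have hle : F2S F grade br ≤ LinearMap.range br.flip := by
    refine Submodule.span_le.mpr ?_
    rintro δ ⟨d, hδ⟩
    obtain ⟨t, rfl⟩ := hδ.exists_eq_flip hL hZ hinner
    exact LinearMap.mem_range_self _ t
  intro δ hδ
  obtain ⟨t, rfl⟩ := hle hδ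
  exact ⟨t, rfl⟩

end SuperBider
end

section
/- Let G = Der(L) be the superderivation algebra of the (n+1)-dimensional Heisenberg superalgebra with n ≥ 3 (basis A, B_{ij}, C_i with the stated brackets). If φ, ψ : G → G are homogeneous linear maps of degree 1 satisfying [φ(x),y] = [x,ψ(y)] for all x,y ∈ G, then φ = 0 and ψ = 0. -/
namespace SuperBider

open Matrix

variable (n : ℕ)

/-- The submodule of skew-symmetric `n × n` complex matrices (spanned by the
`B_{ij} = e_{ij} - e_{ji}`). -/
noncomputable def skewS : Submodule ℂ (Matrix (Fin n) (Fin n) ℂ) where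
  carrier := {M | Mᵀ = -M}
  zero_mem' := by simp
  add_mem' := by
    intro M N hM hN
    simp only [Set.mem_setOf_eq] at *
    rw [Matrix.transpose_add, hM, hN, neg_add]
  smul_mem' := by
    intro c M hM
    simp only [Set.mem_setOf_eq] at *
    rw [Matrix.transpose_smul, hM, smul_neg]

/-- The superderivation algebra `G = Der(L)` of the `(n+1)`-dimensional Heisenberg
superalgebra, modelled as `ℂ × skew matrices × ℂⁿ`: the even part is spanned by
`A = (1,0,0)` and the `B_{ij}` (skew matrices), the odd part by the `C_i = (0,0,e_i)`. -/
abbrev G := ℂ × skewS n × (Fin n → ℂ)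

/-- The even part of `G`: third component zero. -/
noncomputable def evenG : Submodule ℂ (G n) where
  carrier := {p | p.2.2 = 0}
  zero_mem' := rfl
  add_mem' := by intro p q hp hq; simp only [Set.mem_setOf_eq] at *; simp [hp, hq]
  smul_mem' := by intro c p hp; simp only [Set.mem_setOf_eq] at *; simp [hp]

/-- The odd part of `G`: first two components zero. -/
noncomputable def oddG : Submodule ℂ (G n) where
  carrier := {p | p.1 = 0 ∧ p.2.1 = 0}
  zero_mem' := ⟨rfl, rfl⟩
  add_mem' := by
    intro p q hp hq
    simp only [Set.mem_setOf_eq] at *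
    exact ⟨by simp [hp.1, hq.1], by simp [hp.2, hq.2]⟩
  smul_mem' := by
    intro c p hp
    simp only [Set.mem_setOf_eq] at *
    exact ⟨by simp [hp.1], by simp [hp.2]⟩

/-- The grading of `G`. -/
noncomputable def gradeG : ZMod 2 → Submodule ℂ (G n) := fun i => if i = 0 then evenG n else oddG n

/-- The bracket of `G`, encoding `[A,C_i] = C_i`, `[B_{ij},B_{kl}] =
δ_{jk}B_{il} + δ_{il}B_{jk} + δ_{jl}B_{ki} + δ_{ki}B_{lj}` (the matrix commutator),
`[B_{ij},C_k] = δ_{kj}C_i - δ_{ki}C_j` (matrix action on vectors), `[A,B_{ij}] = 0`,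
`[C_i,C_j] = 0`. -/
noncomputable def brG (p q : G n) : G n :=
  ⟨0,
   ⟨p.2.1.1 * q.2.1.1 - q.2.1.1 * p.2.1.1, by
      have hp : (p.2.1.1)ᵀ = -p.2.1.1 := p.2.1.2
      have hq : (q.2.1.1)ᵀ = -q.2.1.1 := q.2.1.2
      show (p.2.1.1 * q.2.1.1 - q.2.1.1 * p.2.1.1)ᵀ
          = -(p.2.1.1 * q.2.1.1 - q.2.1.1 * p.2.1.1)
      rw [Matrix.transpose_sub, Matrix.transpose_mul, Matrix.transpose_mul, hp, hq,
        neg_mul_neg, neg_mul_neg, neg_sub]⟩,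
   p.1 • q.2.2 - q.1 • p.2.2 + p.2.1.1.mulVec q.2.2 - q.2.1.1.mulVec p.2.2⟩

/-- The skew-symmetric matrix `e_{ij} - e_{ji}`. -/
noncomputable def skewSingle {n : ℕ} (i j : Fin n) : skewS n :=
  ⟨Matrix.single i j 1 - Matrix.single j i 1, by
    show (_ : Matrix (Fin n) (Fin n) ℂ)ᵀ = -_
    simp [Matrix.transpose_sub]⟩

lemma exists_ne_ne {n : ℕ} (hn : 3 ≤ n) (i j : Fin n) : ∃ k, k ≠ i ∧ k ≠ j := by
  obtain ⟨k, hk⟩ := Finset.exists_mem_notMem_of_card_lt_card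
    (s := {i, j}) (t := (Finset.univ : Finset (Fin n)))
    (by have := Finset.card_le_two (a := i) (b := j); simp; omega)
  exact ⟨k, by simpa using hk⟩

/-- The center of the Lie algebra of skew-symmetric `n × n` matrices is trivial for `n ≥ 3`. -/
lemma skewS_eq_zero_of_commute {n : ℕ} (hn : 3 ≤ n) (N : skewS n)
    (hN : ∀ S : skewS n, N.1 * S.1 = S.1 * N.1) : N = 0 := by
  have hskew : N.1ᵀ = -N.1 := N.2
  ext k i
  by_cases hki : k = i
  · subst hki
    have h1 := congrFun (congrFun hskew k) k
    simp only [Matrix.transpose_apply, Matrix.neg_apply] at h1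
    simpa using self_eq_neg.mp h1
  · obtain ⟨j, hjk, hji⟩ := exists_ne_ne hn k i
    have h1 := congrFun (congrFun (hN (skewSingle i j)) k) j
    simpa [skewSingle, Matrix.mul_sub, Matrix.sub_mul, Matrix.mul_apply, Matrix.single_apply,
      hki, hjk, hji, Ne.symm hki, Ne.symm hjk, Ne.symm hji] using h1

/-- For `n ≥ 3`, a vector on which all skew-symmetric matrices commute is zero. -/
lemma eq_zero_of_mulVec_comm {n : ℕ} (hn : 3 ≤ n) (u : Fin n → ℂ)
    (hu : ∀ S T : skewS n, S.1 *ᵥ (T.1 *ᵥ u) = T.1 *ᵥ (S.1 *ᵥ u)) : u = 0 := by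
  ext k
  obtain ⟨i, hik, -⟩ := exists_ne_ne hn k k
  obtain ⟨j, hjk, hji⟩ := exists_ne_ne hn k i
  have h1 := congrFun (hu (skewSingle i j) (skewSingle j k)) i
  simpa [skewSingle, Matrix.sub_mulVec, Matrix.single_mulVec, Function.update_apply,
    Pi.single_apply, Matrix.mulVec_sub,
    hik, hjk, hji, Ne.symm hik, Ne.symm hjk, Ne.symm hji] using h1

lemma mem_gradeG_zero {n : ℕ} {p : G n} : p ∈ gradeG n 0 ↔ p.2.2 = 0 := Iff.rfl

lemma mem_gradeG_one {n : ℕ} {p : G n} : p ∈ gradeG n 1 ↔ p.1 = 0 ∧ p.2.1 = 0 := Iff.rfl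

lemma brG_swap {n : ℕ} (p q : G n) : brG n p q = -brG n q p := by
  refine Prod.ext (by simp [brG]) (Prod.ext (Subtype.ext ?_) ?_)
  · simp [brG]
  · simp only [brG, Prod.snd_neg]
    abel

/-- For an intertwining pair of odd maps, the first one kills the odd part. -/
lemma degOne_odd_eq_zero {n : ℕ} (hn : 3 ≤ n) (φ ψ : G n →ₗ[ℂ] G n)
    (hφ : ∀ i : ZMod 2, ∀ p ∈ gradeG n i, φ p ∈ gradeG n (i + 1))
    (h : ∀ p q : G n, brG n (φ p) q = brG n p (ψ q)) (c : Fin n → ℂ) :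
    φ (0, 0, c) = 0 := by
  have one_add : (1 : ZMod 2) + 1 = 0 := rfl
  have central : ∀ c : Fin n → ℂ, (φ (0, 0, c)).2.1 = 0 ∧ (ψ (0, 0, c)).2.1 = 0 := by
    refine fun c => ⟨skewS_eq_zero_of_commute hn _ fun S => ?_,
      skewS_eq_zero_of_commute hn _ fun S => ?_⟩
    · have h1 := congrArg (fun p : G n => p.2.1.1) (h (0, 0, c) (0, S, 0))
      simpa [brG, sub_eq_zero] using h1
    · have h1 := congrArg (fun p : G n => p.2.1.1) (h (0, S, 0) (0, 0, c))
      exact (sub_eq_zero.1 (by simpa [brG] using h1.symm)).symm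
  have scal : ∀ c d : Fin n → ℂ, (φ (0, 0, c)).1 • d = -((ψ (0, 0, d)).1 • c) := by
    intro c d
    have h1 := congrArg (fun p : G n => p.2.2) (h (0, 0, c) (0, 0, d))
    simpa [brG, (central c).1, (central d).2] using h1
  have hodd : (φ (0, 0, c)).2.2 = 0 := by
    have := hφ 1 (0, 0, c) (mem_gradeG_one.2 ⟨rfl, rfl⟩)
    rwa [one_add, mem_gradeG_zero] at this
  have hφ0 : (φ (0, 0, c)).1 = 0 := by
    by_contra hne
    set e₀ : Fin n → ℂ := Pi.single ⟨0, by omega⟩ 1 with he₀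
    set e₁ : Fin n → ℂ := Pi.single ⟨1, by omega⟩ 1 with he₁
    have h00 := congrFun (scal c e₀) ⟨0, by omega⟩
    have h01 := congrFun (scal c e₀) ⟨1, by omega⟩
    have h10 := congrFun (scal c e₁) ⟨0, by omega⟩
    have h11 := congrFun (scal c e₁) ⟨1, by omega⟩
    simp [he₀, he₁] at h00 h01 h10 h11
    grind
  exact Prod.ext hφ0 (Prod.ext (central c).1 hodd)

/-- For an intertwining pair of odd maps, the first one kills the even part. -/
lemma degOne_even_eq_zero {n : ℕ} (hn : 3 ≤ n) (φ ψ : G n →ₗ[ℂ] G n)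
    (hφ : ∀ i : ZMod 2, ∀ p ∈ gradeG n i, φ p ∈ gradeG n (i + 1))
    (hψ : ∀ i : ZMod 2, ∀ p ∈ gradeG n i, ψ p ∈ gradeG n (i + 1))
    (h : ∀ p q : G n, brG n (φ p) q = brG n p (ψ q)) (a : ℂ) (S : skewS n) :
    φ (a, S, 0) = 0 := by
  have hφ1 : ∀ (a : ℂ) (S : skewS n), (φ (a, S, 0)).1 = 0 ∧ (φ (a, S, 0)).2.1 = 0 := fun a S =>
    mem_gradeG_one.1 (hφ 0 (a, S, 0) (mem_gradeG_zero.2 rfl))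
  have hψ1 : ∀ (a : ℂ) (S : skewS n), (ψ (a, S, 0)).1 = 0 ∧ (ψ (a, S, 0)).2.1 = 0 := fun a S =>
    mem_gradeG_one.1 (hψ 0 (a, S, 0) (mem_gradeG_zero.2 rfl))
  have key : ∀ (a b : ℂ) (S T : skewS n),
      -(b • (φ (a, S, 0)).2.2) - T.1 *ᵥ (φ (a, S, 0)).2.2
        = a • (ψ (b, T, 0)).2.2 + S.1 *ᵥ (ψ (b, T, 0)).2.2 := by
    intro a b S T
    have h1 := congrArg (fun p : G n => p.2.2) (h (a, S, 0) (b, T, 0))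
    simpa [brG, hφ1 a S, hψ1 b T] using h1
  set u := (ψ (1, 0, 0)).2.2 with hu
  have hφA : ∀ (a : ℂ) (S : skewS n), (φ (a, S, 0)).2.2 = -(a • u + S.1 *ᵥ u) := by
    intro a S
    have h1 := key a 1 S 0
    simp only [one_smul, ZeroMemClass.coe_zero, Matrix.zero_mulVec, sub_zero] at h1
    rw [← h1, neg_neg]
  have hψA : ∀ T : skewS n, (ψ (0, T, 0)).2.2 = T.1 *ᵥ u := by
    intro T
    have h1 := key 1 0 0 T
    simpa [hφA, Matrix.mulVec_neg, eq_comm] using h1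
  have hu0 : u = 0 := eq_zero_of_mulVec_comm hn u fun S T => by
    have h1 := key 0 0 T S
    simpa [hφA, hψA, Matrix.mulVec_neg] using h1
  exact Prod.ext (hφ1 a S).1 (Prod.ext (hφ1 a S).2 (by simp [hφA, hu0]))

/-- For an intertwining pair of odd maps, the first one vanishes. -/
lemma degOne_left_eq_zero {n : ℕ} (hn : 3 ≤ n) (φ ψ : G n →ₗ[ℂ] G n)
    (hφ : ∀ i : ZMod 2, ∀ p ∈ gradeG n i, φ p ∈ gradeG n (i + 1))
    (hψ : ∀ i : ZMod 2, ∀ p ∈ gradeG n i, ψ p ∈ gradeG n (i + 1))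
    (h : ∀ p q : G n, brG n (φ p) q = brG n p (ψ q)) : φ = 0 := by
  refine LinearMap.ext fun ⟨a, S, c⟩ => ?_
  have hsplit : ((a, S, c) : G n) = (a, S, 0) + (0, 0, c) := by simp
  rw [hsplit, map_add, degOne_even_eq_zero hn φ ψ hφ hψ h, degOne_odd_eq_zero hn φ ψ hφ h,
    add_zero, LinearMap.zero_apply]

/-- if `φ, ψ` are homogeneous linear maps of degree `1` on `G` (n ≥ 3)
with `[φ(x),y] = [x,ψ(y)]` for all `x,y`, then `φ = ψ = 0`. -/
theorem degOne_pair_zero (hn : 3 ≤ n)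
    (φ ψ : G n →ₗ[ℂ] G n)
    (hφ : ∀ i : ZMod 2, ∀ p ∈ gradeG n i, φ p ∈ gradeG n (i + 1))
    (hψ : ∀ i : ZMod 2, ∀ p ∈ gradeG n i, ψ p ∈ gradeG n (i + 1))
    (h : ∀ p q : G n, brG n (φ p) q = brG n p (ψ q)) :
    φ = 0 ∧ ψ = 0 := by
  exact ⟨degOne_left_eq_zero hn φ ψ hφ hψ h, degOne_left_eq_zero hn ψ φ hψ hφ fun p q => by
    rw [brG_swap, ← h, brG_swap, neg_neg]⟩

end SuperBider
end
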